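/- (Source–channel separation, maximum distortion) In the sequence JSCC setup with SPO hypothesis, suppose d_max ≥ 0 and P(dₙ(Sₙ, gₙ(Yₙ)) > d_max) → 0 as n → ∞. Then for every γ > 0, P(iₙ(Sₙ, Yₙ) ≤ R(d_max) − γ) → 0 as n → ∞; i.e., the liminf in probability of the information densities is at least R(d_max). -/

import Mathlib

open scoped BigOperators
open Filter

/-- Probability of an event under a PMF on a finite type. -/
noncomputable def srcPr {S : Type*} [Fintype S] (p : PMF S) (E : Set S) : ℝ :=
  ∑ s, E.indicator (fun s => (p s).toReal) s

/-- Probability of an event for the joint law `P(s, y) = p(s) · W(e(s))(y)`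
of the source and the channel output. -/
noncomputable def jointPr {S X Y : Type*} [Fintype S] [Fintype Y]
    (p : PMF S) (W : X → PMF Y) (e : S → X) (E : Set (S × Y)) : ℝ :=
  ∑ s, ∑ y, E.indicator (fun sy => (p sy.1 * W (e sy.1) sy.2).toReal) (s, y)

/-- The output marginal `q(y) = ∑ s, p(s) · W(e(s))(y)`. -/
noncomputable def outQ {S X Y : Type*} [Fintype S]
    (p : PMF S) (W : X → PMF Y) (e : S → X) (y : Y) : ℝ :=
  ∑ s, (p s * W (e s) y).toReal

/-- The normalized information density `i(s; y) = (1/n) log₂ (W(e(s))(y) / q(y))`. -/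
noncomputable def infoDensity {S X Y : Type*} [Fintype S]
    (n : ℕ) (p : PMF S) (W : X → PMF Y) (e : S → X) (s : S) (y : Y) : ℝ :=
  (1 / (n : ℝ)) * Real.logb 2 ((W (e s) y).toReal / outQ p W e y)

lemma PMF.sum_toReal {α : Type*} [Fintype α] (p : PMF α) : ∑ a, (p a).toReal = 1 := by
  rw [← ENNReal.toReal_sum fun a _ => p.apply_ne_top a, ← tsum_fintype (L := .unconditional α), p.tsum_coe,
    ENNReal.toReal_one]

section

variable {S X Y : Type*} [Fintype S]

lemma outQ_nonneg (p : PMF S) (W : X → PMF Y) (e : S → X) (y : Y) : 0 ≤ outQ p W e y :=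
  Finset.sum_nonneg fun _ _ => ENNReal.toReal_nonneg

lemma le_outQ (p : PMF S) (W : X → PMF Y) (e : S → X) (s : S) (y : Y) :
    (p s * W (e s) y).toReal ≤ outQ p W e y :=
  Finset.single_le_sum (f := fun s => (p s * W (e s) y).toReal)
    (fun _ _ => ENNReal.toReal_nonneg) (Finset.mem_univ s)

/-- Change of measure: where the information density is at most `r`, the joint law is at most
`2 ^ (n * r)` times the product of its marginals. -/
lemma joint_le_of_infoDensity_le {n : ℕ} (hn : 1 ≤ n) (p : PMF S) (W : X → PMF Y) (e : S → X)
    {r : ℝ} {s : S} {y : Y} (h : infoDensity n p W e s y ≤ r) :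
    (p s * W (e s) y).toReal ≤ 2 ^ ((n : ℝ) * r) * (outQ p W e y * (p s).toReal) := by
  rcases (ENNReal.toReal_nonneg (a := p s * W (e s) y)).eq_or_lt with h0 | h0
  · rw [← h0]
    have := outQ_nonneg p W e y
    positivity
  have hq : 0 < outQ p W e y := h0.trans_le (le_outQ p W e s y)
  rw [ENNReal.toReal_mul] at h0 ⊢
  have hW : 0 < (W (e s) y).toReal := pos_of_mul_pos_right h0 ENNReal.toReal_nonneg
  have hn' : (0 : ℝ) < n := by exact_mod_cast hn
  have hlog : Real.logb 2 ((W (e s) y).toReal / outQ p W e y) ≤ n * r := by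
    rwa [infoDensity, one_div_mul_eq_div, div_le_iff₀' hn'] at h
  rw [Real.logb_le_iff_le_rpow one_lt_two (div_pos hW hq), div_le_iff₀ hq] at hlog
  calc (p s).toReal * (W (e s) y).toReal
      ≤ (p s).toReal * (2 ^ ((n : ℝ) * r) * outQ p W e y) := by gcongr
    _ = _ := by ring

variable [Fintype Y]

lemma sum_outQ (p : PMF S) (W : X → PMF Y) (e : S → X) : ∑ y, outQ p W e y = 1 := by
  simp only [outQ]
  rw [Finset.sum_comm]
  simp only [ENNReal.toReal_mul, ← Finset.mul_sum, PMF.sum_toReal, mul_one]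

lemma jointPr_nonneg (p : PMF S) (W : X → PMF Y) (e : S → X) (E : Set (S × Y)) :
    0 ≤ jointPr p W e E :=
  Finset.sum_nonneg fun _ _ => Finset.sum_nonneg fun _ _ =>
    Set.indicator_nonneg (fun _ _ => ENNReal.toReal_nonneg) _

lemma jointPr_mono (p : PMF S) (W : X → PMF Y) (e : S → X) {E F : Set (S × Y)} (h : E ⊆ F) :
    jointPr p W e E ≤ jointPr p W e F :=
  Finset.sum_le_sum fun _ _ => Finset.sum_le_sum fun _ _ =>
    Set.indicator_le_indicator_of_subset h (fun _ => ENNReal.toReal_nonneg) _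

lemma jointPr_union_le (p : PMF S) (W : X → PMF Y) (e : S → X) (E F : Set (S × Y)) :
    jointPr p W e (E ∪ F) ≤ jointPr p W e E + jointPr p W e F := by
  simp only [jointPr, ← Finset.sum_add_distrib]
  refine Finset.sum_le_sum fun s _ => Finset.sum_le_sum fun y _ => ?_
  rw [← Set.indicator_union_add_inter_apply]
  exact le_add_of_nonneg_right (Set.indicator_nonneg (fun _ _ => ENNReal.toReal_nonneg) _)

lemma jointPr_fst_preimage (p : PMF S) (W : X → PMF Y) (e : S → X) (B : Set S) :
    jointPr p W e (Prod.fst ⁻¹' B) = srcPr p B := by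
  refine Finset.sum_congr rfl fun s _ => ?_
  by_cases hs : s ∈ B
  · simp [hs, ENNReal.toReal_mul, ← Finset.mul_sum, PMF.sum_toReal]
  · simp [hs]

lemma jointPr_infoDensity_le_inter {n : ℕ} (hn : 1 ≤ n) (p : PMF S) (W : X → PMF Y)
    (e : S → X) (r : ℝ) (G : Set (S × Y)) {c : ℝ}
    (hG : ∀ y, srcPr p {s | (s, y) ∈ G} ≤ c) :
    jointPr p W e ({sy | infoDensity n p W e sy.1 sy.2 ≤ r} ∩ G) ≤ 2 ^ ((n : ℝ) * r) * c := by
  calc jointPr p W e ({sy | infoDensity n p W e sy.1 sy.2 ≤ r} ∩ G)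
      ≤ ∑ s, ∑ y, 2 ^ ((n : ℝ) * r) *
          (outQ p W e y * {s | (s, y) ∈ G}.indicator (fun s => (p s).toReal) s) := by
        refine Finset.sum_le_sum fun s _ => Finset.sum_le_sum fun y _ => ?_
        have hq := outQ_nonneg p W e y
        refine Set.indicator_apply_le' (fun h => ?_) fun _ => ?_
        · rw [Set.indicator_of_mem (show s ∈ {s | (s, y) ∈ G} from h.2)]
          exact joint_le_of_infoDensity_le hn p W e h.1
        · have : 0 ≤ {s | (s, y) ∈ G}.indicator (fun s => (p s).toReal) s :=
            Set.indicator_nonneg (fun _ _ => ENNReal.toReal_nonneg) _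
          positivity
    _ = 2 ^ ((n : ℝ) * r) * ∑ y, outQ p W e y * srcPr p {s | (s, y) ∈ G} := by
        rw [Finset.sum_comm]
        simp only [srcPr, Finset.mul_sum]
    _ ≤ 2 ^ ((n : ℝ) * r) * ∑ y, outQ p W e y * c := by
        gcongr with y
        · exact outQ_nonneg p W e y
        · exact hG y
    _ = 2 ^ ((n : ℝ) * r) * c := by rw [← Finset.sum_mul, sum_outQ, one_mul]

end

lemma tendsto_two_rpow_neg_mul_add {γ : ℝ} (hγ : 0 < γ) {k : ℕ → ℝ}
    (hk : Tendsto k atTop (nhds 0)) :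
    Tendsto (fun n : ℕ => (2 : ℝ) ^ (-((n : ℝ) * (γ + k n)))) atTop (nhds 0) := by
  have h : Tendsto (fun n : ℕ => (n : ℝ) * (γ + k n)) atTop atTop :=
    tendsto_natCast_atTop_atTop.atTop_mul_pos hγ (by simpa using hk.const_add γ)
  exact (tendsto_rpow_atBot_of_base_gt_one 2 one_lt_two).comp (tendsto_neg_atTop_atBot.comp h)

/-- Source–channel separation under the maximum distortion criterion: if a JSCC scheme
for a sphere-packing optimal (SPO) source achieves maximum distortion `dmax`
(i.e. `P(dₙ(Sₙ, gₙ(Yₙ)) > dmax) → 0`), then for every `γ > 0` the probability that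
the information density lies below `R(dmax) − γ` vanishes, i.e. the liminf in
probability of the information densities is at least `R(dmax)`. -/
theorem jscc_separation_max_distortion
    (S X Y Sh : ℕ → Type)
    [∀ n, Fintype (S n)] [∀ n, Nonempty (S n)]
    [∀ n, Fintype (X n)] [∀ n, Nonempty (X n)]
    [∀ n, Fintype (Y n)] [∀ n, Nonempty (Y n)]
    [∀ n, Fintype (Sh n)] [∀ n, Nonempty (Sh n)]
    (p : ∀ n, PMF (S n)) (W : ∀ n, X n → PMF (Y n))
    (e : ∀ n, S n → X n) (g : ∀ n, Y n → Sh n)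
    (d : ∀ n, S n → Sh n → ℝ) (hd : ∀ n s sh, 0 ≤ d n s sh)
    -- SPO hypothesis
    (A : ∀ n, Set (S n)) (R : ℝ → ℝ) (k : ℕ → ℝ)
    (hk : Tendsto k atTop (nhds 0))
    (hA : Tendsto (fun n => srcPr (p n) (A n)ᶜ) atTop (nhds 0))
    (hSPO : ∀ n, 1 ≤ n → ∀ α : ℝ, 0 ≤ α → ∀ sh : Sh n,
      srcPr (p n) {s | s ∈ A n ∧ d n s sh ≤ α} ≤ 2 ^ (-(n : ℝ) * (R α + k n)))
    -- the scheme achieves maximum distortion level `dmax`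
    (dmax : ℝ) (hdmax : 0 ≤ dmax)
    (hscheme : Tendsto
      (fun n => jointPr (p n) (W n) (e n) {sy | dmax < d n sy.1 (g n sy.2)})
      atTop (nhds 0)) :
    ∀ γ : ℝ, 0 < γ →
      Tendsto
        (fun n => jointPr (p n) (W n) (e n)
          {sy | infoDensity n (p n) (W n) (e n) sy.1 sy.2 ≤ R dmax - γ})
        atTop (nhds 0) := by
  intro γ hγ
  have hlim := (hA.add hscheme).add (tendsto_two_rpow_neg_mul_add hγ hk)
  simp only [add_zero] at hlim
  refine tendsto_of_tendsto_of_tendsto_of_le_of_le' tendsto_const_nhds hlim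
    (Eventually.of_forall fun n => jointPr_nonneg _ _ _ _) ?_
  filter_upwards [eventually_ge_atTop 1] with n hn
  set E := {sy : S n × Y n | infoDensity n (p n) (W n) (e n) sy.1 sy.2 ≤ R dmax - γ}
  set D := {sy : S n × Y n | dmax < d n sy.1 (g n sy.2)}
  set G := {sy : S n × Y n | sy.1 ∈ A n ∧ d n sy.1 (g n sy.2) ≤ dmax}
  have hsub : E ⊆ (Prod.fst ⁻¹' (A n)ᶜ ∪ D) ∪ (E ∩ G) := by
    intro sy hE
    by_cases hs : sy.1 ∈ A n
    · rcases lt_or_ge dmax (d n sy.1 (g n sy.2)) with h | h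
      · exact Or.inl (Or.inr h)
      · exact Or.inr ⟨hE, hs, h⟩
    · exact Or.inl (Or.inl hs)
  have hEG : jointPr (p n) (W n) (e n) (E ∩ G) ≤ 2 ^ (-((n : ℝ) * (γ + k n))) := by
    refine (jointPr_infoDensity_le_inter hn (p n) (W n) (e n) (R dmax - γ) G
      fun y => hSPO n hn dmax hdmax (g n y)).trans_eq ?_
    rw [← Real.rpow_add two_pos]
    ring_nf
  calc jointPr (p n) (W n) (e n) E
      ≤ jointPr (p n) (W n) (e n) ((Prod.fst ⁻¹' (A n)ᶜ ∪ D) ∪ (E ∩ G)) :=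
        jointPr_mono _ _ _ hsub
    _ ≤ jointPr (p n) (W n) (e n) (Prod.fst ⁻¹' (A n)ᶜ ∪ D)
          + jointPr (p n) (W n) (e n) (E ∩ G) := jointPr_union_le _ _ _ _ _
    _ ≤ jointPr (p n) (W n) (e n) (Prod.fst ⁻¹' (A n)ᶜ) + jointPr (p n) (W n) (e n) D
          + 2 ^ (-((n : ℝ) * (γ + k n))) :=
        add_le_add (jointPr_union_le _ _ _ _ _) hEG
    _ = _ := by rw [jointPr_fst_preimage]
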